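/- arXiv:1102.3214 — 5 statements merged into one kernel-verified Lean document; each statement's English description precedes it below -/
import Mathlib

section
/- For every integer k ≥ 1 and every real P > 0, there exists exactly one real number φ in the interval [1,k] satisfying (1 + P·φ)^{k−1} = (1 + (P/k)·φ·(k − φ))^{k}. -/
/-- The logarithmic gap between the two sides is strictly decreasing on `[1, k]`. -/
lemma lqg_gap_strictAnti (k : ℕ) (hk : 1 ≤ k) (P : ℝ) (hP : 0 < P) :
    StrictAntiOn (fun x : ℝ => (k : ℝ) * Real.log (1 + (P / k) * x * ((k : ℝ) - x))
      - ((k : ℝ) - 1) * Real.log (1 + P * x)) (Set.Icc (1 : ℝ) (k : ℝ)) := by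
  have hk0 : (0 : ℝ) < k := by exact_mod_cast hk
  have hd : ∀ x ∈ Set.Icc (1 : ℝ) (k : ℝ),
      HasDerivAt (fun x : ℝ => (k : ℝ) * Real.log (1 + (P / k) * x * ((k : ℝ) - x))
      - ((k : ℝ) - 1) * Real.log (1 + P * x))
      ((k : ℝ) * ((P / k * ((k : ℝ) - x) + P / k * x * (-1)) / (1 + (P / k) * x * ((k : ℝ) - x)))
        - ((k : ℝ) - 1) * (P / (1 + P * x))) x := by
    intro x hx
    have hx0 : 0 < x := by linarith [hx.1]
    have hx1 : 0 ≤ (k : ℝ) - x := by linarith [hx.2]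
    have hg : 0 < 1 + (P / k) * x * ((k : ℝ) - x) := by positivity
    have hb : 0 < 1 + P * x := by positivity
    have h1 : HasDerivAt (fun x : ℝ => 1 + (P / k) * x * ((k : ℝ) - x))
        (P / k * ((k : ℝ) - x) + P / k * x * (-1)) x := by
      have := (((hasDerivAt_id x).const_mul (P / k)).mul
        ((hasDerivAt_id x).const_sub (k : ℝ))).const_add 1
      simpa using this
    have h2 : HasDerivAt (fun x : ℝ => 1 + P * x) P x := by
      simpa using ((hasDerivAt_id x).const_mul P).const_add 1
    exact ((h1.log hg.ne').const_mul _).sub ((h2.log hb.ne').const_mul _)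
  apply strictAntiOn_of_deriv_neg (convex_Icc _ _)
  · exact fun x hx => (hd x hx).continuousAt.continuousWithinAt
  · intro x hx
    have hx := interior_subset hx
    rw [(hd x hx).deriv]
    have hx0 : 0 < x := by linarith [hx.1]
    have hx1 : 0 ≤ (k : ℝ) - x := by linarith [hx.2]
    have hg : 0 < 1 + (P / k) * x * ((k : ℝ) - x) := by positivity
    have hb : 0 < 1 + P * x := by positivity
    rw [← mul_div_assoc, ← mul_div_assoc, sub_neg, div_lt_div_iff₀ hg hb]
    have key : (k : ℝ) * (P / k * ((k : ℝ) - x) + P / k * x * (-1)) * (1 + P * x)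
        - ((k : ℝ) - 1) * P * (1 + (P / k) * x * ((k : ℝ) - x))
        = P * (1 - 2 * x + P * x * (1 - x) - P * x ^ 2 / k) := by
      field_simp
      ring
    have h3 : P * x * (1 - x) ≤ 0 :=
      mul_nonpos_of_nonneg_of_nonpos (by positivity) (by linarith [hx.1])
    have h4 : 0 < P * x ^ 2 / k := by positivity
    have h5 : P * (1 - 2 * x + P * x * (1 - x) - P * x ^ 2 / k) < 0 :=
      mul_neg_of_pos_of_neg hP (by linarith [hx.1])
    linarith

/-- For every integer `k ≥ 1` and every real `P > 0`, there exists exactly one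
real number `φ` in the interval `[1, k]` satisfying
`(1 + P·φ)^(k−1) = (1 + (P/k)·φ·(k − φ))^k`. -/
theorem lqg_power_gain_exists_unique (k : ℕ) (hk : 1 ≤ k) (P : ℝ) (hP : 0 < P) :
    ∃! φ : ℝ, φ ∈ Set.Icc (1 : ℝ) (k : ℝ) ∧
      (1 + P * φ) ^ (k - 1) = (1 + (P / k) * φ * ((k : ℝ) - φ)) ^ k := by
  have hk0 : (0 : ℝ) < k := by exact_mod_cast hk
  have hk1 : (1 : ℝ) ≤ k := by exact_mod_cast hk
  have hex : ∃ φ ∈ Set.Icc (1 : ℝ) (k : ℝ),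
      (1 + (P / k) * φ * ((k : ℝ) - φ)) ^ k - (1 + P * φ) ^ (k - 1) = 0 := by
    have hc : ContinuousOn (fun φ : ℝ =>
        (1 + (P / k) * φ * ((k : ℝ) - φ)) ^ k - (1 + P * φ) ^ (k - 1))
        (Set.Icc (1 : ℝ) (k : ℝ)) := by fun_prop
    refine intermediate_value_Icc' hk1 hc ⟨?_, ?_⟩
    · have : (1 : ℝ) ≤ (1 + P * k) ^ (k - 1) :=
        one_le_pow₀ (by have : 0 < P * k := by positivity
                        linarith)
      simpa using this
    · have hP1 : 0 < 1 + P := by linarith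
      have hle : P / (k * (1 + P)) ≤ 1 := by
        rw [div_le_one (by positivity)]
        nlinarith
      have hB := one_add_mul_le_pow (a := -(P / (k * (1 + P)))) (by linarith) k
      have e1 : 1 + (k : ℝ) * -(P / (k * (1 + P))) = 1 / (1 + P) := by
        field_simp
        ring
      have e2 : 1 + P / k * 1 * ((k : ℝ) - 1) = (1 + P) * (1 + -(P / (k * (1 + P)))) := by
        field_simp
        ring
      rw [e1] at hB
      have e3 : (1 + P) ^ k = (1 + P) ^ (k - 1) * (1 + P) := by
        rw [← pow_succ, Nat.sub_add_cancel hk]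
      show 0 ≤ _ - _
      rw [e2, mul_pow, mul_one, sub_nonneg]
      calc (1 + P) ^ (k - 1) = (1 + P) ^ k * (1 / (1 + P)) := by
            rw [e3]; field_simp
        _ ≤ _ := by gcongr
  obtain ⟨φ, hφ, h0⟩ := hex
  refine ⟨φ, ⟨hφ, by linarith⟩, ?_⟩
  rintro ψ ⟨hψ, h1⟩
  have hlog : ∀ x : ℝ, (1 + P * x) ^ (k - 1) = (1 + (P / k) * x * ((k : ℝ) - x)) ^ k →
      (k : ℝ) * Real.log (1 + (P / k) * x * ((k : ℝ) - x))
      - ((k : ℝ) - 1) * Real.log (1 + P * x) = 0 := by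
    intro x h
    have := congrArg Real.log h
    rw [Real.log_pow, Real.log_pow, Nat.cast_sub hk, Nat.cast_one] at this
    linarith
  apply (lqg_gap_strictAnti k hk P hP).injOn hψ hφ
  show _ - _ = _ - _
  rw [hlog ψ h1, hlog φ (by linarith)]
end

section
/- Fix an integer k ≥ 2. For P > 0 let φ(P) denote the unique solution in [1,k] of (1 + P·φ)^{k−1} = (1 + (P/k)·φ·(k − φ))^{k}. Then φ(P) → k as P → ∞. -/
open Filter

/-- Fix an integer `k ≥ 2`. For `P > 0` let `φ(P)` denote the unique solution
in `[1, k]` of `(1 + P·φ)^(k−1) = (1 + (P/k)·φ·(k − φ))^k`. Then `φ(P) → k` as `P → ∞`. -/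
theorem lqg_power_gain_tendsto (k : ℕ) (hk : 2 ≤ k) (φ : ℝ → ℝ)
    (hφ : ∀ P : ℝ, 0 < P → φ P ∈ Set.Icc (1 : ℝ) (k : ℝ) ∧
      (1 + P * φ P) ^ (k - 1) = (1 + (P / k) * φ P * ((k : ℝ) - φ P)) ^ k) :
    Tendsto φ atTop (nhds (k : ℝ)) := by
  have hk0 : (0 : ℝ) < k := by
    have : 0 < k := by omega
    exact_mod_cast this
  rw [Metric.tendsto_atTop]
  intro ε hε
  refine ⟨((k : ℝ) / ε) ^ k, fun P hP => ?_⟩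
  have hP0 : 0 < P := lt_of_lt_of_le (by positivity) hP
  obtain ⟨⟨h1, h2⟩, he⟩ := hφ P hP0
  set x := φ P with hx
  rw [Real.dist_eq, abs_sub_comm, abs_of_nonneg (by linarith)]
  by_contra! hcon
  set t : ℝ := ((k : ℝ) - x) / k with ht
  have htε : ε / k ≤ t := by rw [ht]; gcongr
  have ht0 : 0 < t := lt_of_lt_of_le (by positivity) htε
  have ht1 : t ≤ 1 := by
    rw [ht, div_le_one hk0]; linarith
  have heq : 1 + (P / k) * x * ((k : ℝ) - x) = 1 + t * (P * x) := by
    rw [ht]; field_simp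
  rw [heq] at he
  have hPx : P ≤ P * x := by nlinarith
  have ha : 0 < 1 + P * x := by linarith
  have hle : (t * (1 + P * x)) ^ k ≤ (1 + P * x) ^ (k - 1) := by
    rw [he]
    have : 0 ≤ t * (1 + P * x) := by positivity
    gcongr
    nlinarith
  have hks : (1 + P * x) ^ k = (1 + P * x) ^ (k - 1) * (1 + P * x) := by
    rw [← pow_succ]; congr 1; omega
  rw [mul_pow, hks] at hle
  have hpos : 0 < (1 + P * x) ^ (k - 1) := by positivity
  have h3 : t ^ k * (1 + P * x) ≤ 1 := by
    by_contra! hc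
    nlinarith
  have h4 : (ε / k) ^ k ≤ t ^ k := by gcongr
  have h5 : (ε / k) ^ k * ((k : ℝ) / ε) ^ k = 1 := by
    rw [← mul_pow]
    have : ε / k * ((k : ℝ) / ε) = 1 := by field_simp
    rw [this, one_pow]
  have h6 : (ε / k) ^ k * ((k : ℝ) / ε) ^ k < t ^ k * (1 + P * x) := by
    have : ((k : ℝ) / ε) ^ k < 1 + P * x := by linarith
    apply mul_lt_mul' h4 this <;> positivity
  linarith
end

section
/- Let a > 1 and b > 0 be real numbers, and define C = (c_1, c_2) = −((a⁴−1)/(2a³b))·(1, 1) and K_s = (b²/(2a²))·[[ (a²+1)² + 2/(a²−1), a⁴+1 ], [ a⁴+1, (a²+1)² + 2/(a²−1) ]]. Then ( −c_1·(K_s)₁₁ − c_2·(K_s)₁₂ ) / ( C·K_s·Cᵀ + 1 ) < b/a. -/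
open Matrix

/-- Let `a > 1` and `b > 0` be real, `C = (c₁, c₂) = −((a⁴−1)/(2a³b))·(1,1)`
and `K_s` the explicit steady-state covariance matrix. Then
`(−c₁·(K_s)₁₁ − c₂·(K_s)₁₂) / (C·K_s·Cᵀ + 1) < b/a`. -/
theorem ol_coefficient_lt_lqg_coefficient (a b : ℝ) (ha : 1 < a) (hb : 0 < b)
    (c : ℝ) (hc : c = -((a ^ 4 - 1) / (2 * a ^ 3 * b)))
    (C : Matrix (Fin 1) (Fin 2) ℝ) (hC : C = Matrix.of ![![c, c]])
    (Ks : Matrix (Fin 2) (Fin 2) ℝ)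
    (hKs : Ks = (b ^ 2 / (2 * a ^ 2)) • Matrix.of
      ![![(a ^ 2 + 1) ^ 2 + 2 / (a ^ 2 - 1), a ^ 4 + 1],
        ![a ^ 4 + 1, (a ^ 2 + 1) ^ 2 + 2 / (a ^ 2 - 1)]]) :
    (-c * Ks 0 0 - c * Ks 0 1) / ((C * Ks * Cᵀ) 0 0 + 1) < b / a := by
  have h1 : 0 < a ^ 2 - 1 := by nlinarith
  have h1' : a ^ 2 - 1 ≠ 0 := h1.ne'
  have ha0 : 0 < a := by linarith
  have ha' : a ≠ 0 := ha0.ne'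
  have hb' : b ≠ 0 := hb.ne'
  have hS : Ks 0 0 + Ks 0 1 = b ^ 2 * a ^ 4 / (a ^ 2 - 1) := by
    subst hKs
    simp
    field_simp
    ring
  have hS2 : Ks 1 0 + Ks 1 1 = Ks 0 0 + Ks 0 1 := by
    subst hKs
    simp
    ring
  have hN : -c * Ks 0 0 - c * Ks 0 1 = (a ^ 2 + 1) * a * b / 2 := by
    have : -c * Ks 0 0 - c * Ks 0 1 = -c * (Ks 0 0 + Ks 0 1) := by ring
    rw [this, hS, hc]
    field_simp
    ring
  have hD : (C * Ks * Cᵀ) 0 0 + 1 = ((a ^ 4 - 1) * (a ^ 2 + 1) + 2 * a ^ 2) / (2 * a ^ 2) := by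
    have : (C * Ks * Cᵀ) 0 0 = c ^ 2 * ((Ks 0 0 + Ks 0 1) + (Ks 1 0 + Ks 1 1)) := by
      subst hC
      simp [Matrix.mul_apply, Fin.sum_univ_two, Matrix.vecMul, dotProduct]
      ring
    rw [this, hS2, hS, hc]
    field_simp
    ring
  have hp : 0 < (a ^ 4 - 1) * (a ^ 2 + 1) + 2 * a ^ 2 := by
    have : (a ^ 4 - 1) * (a ^ 2 + 1) = (a ^ 2 - 1) * (a ^ 2 + 1) ^ 2 := by ring
    rw [this]
    positivity
  rw [hN, hD, div_lt_div_iff₀ (by positivity) ha0, mul_div_assoc', lt_div_iff₀ (by positivity)]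
  have : 0 < b * (a ^ 2 - 1) := by positivity
  nlinarith
end

section
/- Let k ≥ 1 be an integer and a > 1 real. Let F ∈ ℂ^{k×k} be the unitary DFT matrix with entries F_{jl} = k^{−1/2}·e^{−2π√(−1)(j−1)(l−1)/k}, and set K̃_z = F·diag(0,…,0,k)·Fᴴ. Then: (i) K̃_z is Hermitian positive semidefinite, has rank 1, and all its diagonal entries equal 1; (ii) for G = F·diag(λ_1,…,λ_k)·Fᴴ with λ_j = λ_1/a^{2(j−1)} and λ_1 = (a^{2k}−1)/k, one has tr(G·K̃_z) = k·λ_k = (a^{2k}−1)/a^{2(k−1)}. -/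
open Matrix
open scoped ComplexOrder

theorem dft_unitary_aux (k : ℕ) (hk : 1 ≤ k)
    (F : Matrix (Fin k) (Fin k) ℂ)
    (hF : F = Matrix.of (fun j l : Fin k =>
      ((1 / Real.sqrt k : ℝ) : ℂ) *
        Complex.exp (-2 * Real.pi * Complex.I * (j : ℕ) * (l : ℕ) / k))) :
    Fᴴ * F = 1 := by
  have hk0 : (k : ℂ) ≠ 0 := by exact_mod_cast (by omega : k ≠ 0)
  have hs : ((1 / Real.sqrt k : ℝ) : ℂ) * ((1 / Real.sqrt k : ℝ) : ℂ) = 1 / k := by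
    rw [← Complex.ofReal_mul, div_mul_div_comm, Real.mul_self_sqrt (Nat.cast_nonneg k)]
    push_cast
    ring
  set ζ : ℂ := Complex.exp (2 * Real.pi * Complex.I / k) with hζ
  have hprim : IsPrimitiveRoot ζ k := Complex.isPrimitiveRoot_exp k (by omega)
  have hζ0 : ζ ≠ 0 := Complex.exp_ne_zero _
  have hterm : ∀ i l j : Fin k, (starRingEnd ℂ) (F j i) * F j l
      = (1 / k) * (ζ ^ (i : ℕ) * (ζ ^ (l : ℕ))⁻¹) ^ (j : ℕ) := by
    intro i l j
    have h1 : (starRingEnd ℂ) (Complex.exp (-2 * Real.pi * Complex.I * (j : ℕ) * (i : ℕ) / k))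
        * Complex.exp (-2 * Real.pi * Complex.I * (j : ℕ) * (l : ℕ) / k)
        = (ζ ^ (i : ℕ) * (ζ ^ (l : ℕ))⁻¹) ^ (j : ℕ) := by
      rw [hζ, ← Complex.exp_conj, ← Complex.exp_nat_mul, ← Complex.exp_nat_mul,
        ← Complex.exp_neg, ← Complex.exp_add, ← Complex.exp_add, ← Complex.exp_nat_mul]
      congr 1
      simp only [map_div₀, map_mul, map_neg, Complex.conj_I, Complex.conj_ofReal, map_natCast,
        map_ofNat]
      ring
    rw [← h1, ← hs, hF]
    simp only [Matrix.of_apply, map_mul, Complex.conj_ofReal]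
    ring
  ext i l
  rw [Matrix.mul_apply]
  simp only [Matrix.conjTranspose_apply]
  have : ∀ j, star (F j i) * F j l
      = (1 / k) * (ζ ^ (i : ℕ) * (ζ ^ (l : ℕ))⁻¹) ^ (j : ℕ) := hterm i l
  simp only [this]
  rw [← Finset.mul_sum, Fin.sum_univ_eq_sum_range
    (fun j => (ζ ^ (i : ℕ) * (ζ ^ (l : ℕ))⁻¹) ^ j) k]
  by_cases h : i = l
  · subst h
    rw [mul_inv_cancel₀ (pow_ne_zero _ hζ0)]
    simp [hk0]
  · have hne : ζ ^ (i : ℕ) * (ζ ^ (l : ℕ))⁻¹ ≠ 1 := by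
      intro h1
      have h2 := (mul_inv_eq_one₀ (pow_ne_zero _ hζ0)).1 h1
      exact h (Fin.ext (hprim.pow_inj i.2 l.2 h2))
    rw [geom_sum_eq hne, Matrix.one_apply_ne h, mul_pow, inv_pow, ← pow_mul, ← pow_mul,
      mul_comm (i : ℕ), mul_comm (l : ℕ), pow_mul, pow_mul, hprim.pow_eq_one]
    simp

/-- Let `k ≥ 1`, `a > 1`, `F` the unitary DFT matrix with entries
`F_{jl} = k^{−1/2}·e^{−2πi(j−1)(l−1)/k}` (zero-indexed below), and
`K̃_z = F·diag(0,…,0,k)·Fᴴ`. Then (i) `K̃_z` is Hermitian positive semidefinite, has rank `1`,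
and all its diagonal entries equal `1`; and (ii) for `G = F·diag(λ₁,…,λ_k)·Fᴴ` with
`λ_j = λ₁/a^{2(j−1)}` and `λ₁ = (a^{2k}−1)/k`, one has
`tr(G·K̃_z) = k·λ_k = (a^{2k}−1)/a^{2(k−1)}`. -/
theorem rank_one_noise_covariance (k : ℕ) (hk : 1 ≤ k) (a : ℝ) (ha : 1 < a)
    (F : Matrix (Fin k) (Fin k) ℂ)
    (hF : F = Matrix.of (fun j l : Fin k =>
      ((1 / Real.sqrt k : ℝ) : ℂ) *
        Complex.exp (-2 * Real.pi * Complex.I * (j : ℕ) * (l : ℕ) / k)))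
    (Kz : Matrix (Fin k) (Fin k) ℂ)
    (hKz : Kz = F * Matrix.diagonal (fun j : Fin k =>
      if (j : ℕ) = k - 1 then (k : ℂ) else 0) * Fᴴ)
    (lam1 : ℝ) (hlam1 : lam1 = (a ^ (2 * k) - 1) / k)
    (G : Matrix (Fin k) (Fin k) ℂ)
    (hG : G = F * Matrix.diagonal (fun j : Fin k =>
      ((lam1 / a ^ (2 * (j : ℕ)) : ℝ) : ℂ)) * Fᴴ) :
    Kz.PosSemidef ∧ Kz.rank = 1 ∧ (∀ j, Kz j j = 1) ∧
    (G * Kz).trace = (((k : ℝ) * (lam1 / a ^ (2 * (k - 1))) : ℝ) : ℂ) ∧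
    (G * Kz).trace = (((a ^ (2 * k) - 1) / a ^ (2 * (k - 1)) : ℝ) : ℂ) := by
  have hU : Fᴴ * F = 1 := dft_unitary_aux k hk F hF
  have hU' : F * Fᴴ = 1 := mul_eq_one_comm.1 hU
  have hkR : (k : ℝ) ≠ 0 := by exact_mod_cast (by omega : k ≠ 0)
  have hk0 : (k : ℂ) ≠ 0 := by exact_mod_cast (by omega : k ≠ 0)
  set m : Fin k := ⟨k - 1, by omega⟩ with hm
  have hmi : ∀ j : Fin k, ((j : ℕ) = k - 1) ↔ j = m := by
    intro j
    simp [hm, Fin.ext_iff]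
  simp only [hmi] at hKz
  have hdetF : IsUnit F.det := (Matrix.isUnit_iff_isUnit_det F).1 (IsUnit.of_mul_eq_one _ hU')
  have hdetF' : IsUnit Fᴴ.det := (Matrix.isUnit_iff_isUnit_det _).1 (IsUnit.of_mul_eq_one _ hU)
  have htr : (G * Kz).trace = (((k : ℝ) * (lam1 / a ^ (2 * (k - 1))) : ℝ) : ℂ) := by
    set D1 := Matrix.diagonal (fun j : Fin k => ((lam1 / a ^ (2 * (j : ℕ)) : ℝ) : ℂ)) with hD1
    set D2 := Matrix.diagonal (fun j : Fin k => if j = m then (k : ℂ) else 0) with hD2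
    have h1 : G * Kz = F * (D1 * D2) * Fᴴ := by
      rw [hG, hKz]
      calc F * D1 * Fᴴ * (F * D2 * Fᴴ) = F * D1 * (Fᴴ * F) * D2 * Fᴴ := by
            simp only [Matrix.mul_assoc]
        _ = _ := by rw [hU]; simp only [Matrix.mul_assoc, Matrix.one_mul]
    rw [h1, Matrix.trace_mul_comm, ← Matrix.mul_assoc, hU, Matrix.one_mul, hD1, hD2,
      Matrix.diagonal_mul_diagonal, Matrix.trace_diagonal]
    simp only [mul_ite, mul_zero, Finset.sum_ite_eq', Finset.mem_univ, if_true]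
    simp only [hm]
    push_cast
    ring
  refine ⟨?_, ?_, ?_, htr, ?_⟩
  · rw [hKz]
    apply Matrix.PosSemidef.mul_mul_conjTranspose_same
    apply Matrix.PosSemidef.diagonal
    intro j
    dsimp only
    split_ifs
    · exact Nat.cast_nonneg k
    · exact le_rfl
  · rw [hKz, Matrix.rank_mul_eq_left_of_isUnit_det _ _ hdetF',
      Matrix.rank_mul_eq_right_of_isUnit_det _ _ hdetF, Matrix.rank_diagonal]
    simp [hk0]
  · intro j
    rw [hKz, Matrix.mul_apply]
    simp only [Matrix.mul_diagonal, mul_ite, mul_zero, ite_mul, zero_mul, Finset.sum_ite_eq',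
      Finset.mem_univ, if_true, Matrix.conjTranspose_apply]
    have h : F j m * star (F j m) = 1 / k := by
      change F j m * (starRingEnd ℂ) (F j m) = 1 / k
      rw [Complex.mul_conj, Complex.normSq_eq_norm_sq, hF]
      have : (-2 * Real.pi * Complex.I * ((j : ℕ) : ℂ) * ((m : ℕ) : ℂ) / k)
          = ((-2 * Real.pi * (j : ℕ) * (m : ℕ) / k : ℝ) : ℂ) * Complex.I := by
        push_cast
        ring
      rw [Matrix.of_apply, this, norm_mul, Complex.norm_exp_ofReal_mul_I, Complex.norm_real,
        mul_one, Real.norm_eq_abs, sq_abs, div_pow, Real.sq_sqrt (Nat.cast_nonneg k)]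
      push_cast
      ring
    rw [mul_right_comm, h]
    field_simp
  · rw [htr, hlam1]
    congr 1
    field_simp
end

section
/- Let δ > 0, ε ∈ [0,1), and N a positive integer with N·δ < 1 − ε. Then for every Lebesgue-measurable set T ⊆ (0,1) with Lebesgue measure at most ε, there exist N points x_1 < x_2 < … < x_N in (0,1) \ T such that x_{i+1} − x_i ≥ δ for every i = 1,…,N−1. -/
open MeasureTheory in
lemma packing_aux (δ : ℝ) (hδ : 0 < δ) (N : ℕ) : ∀ (c : ℝ) (S : Set ℝ), (N : ℝ) * δ < c →
    BddBelow S → ENNReal.ofReal c ≤ volume S →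
    ∃ x : ℕ → ℝ, (∀ i < N, x i ∈ S) ∧ ∀ i, i + 1 < N → x i + δ ≤ x (i + 1) := by
  induction N with
  | zero => intro c S _ _ _; exact ⟨fun _ => 0, by simp, by simp⟩
  | succ n ih =>
    intro c S hc hb hv
    push_cast at hc
    have hnd : 0 ≤ (n : ℝ) * δ := by positivity
    have hc0 : 0 < c := by nlinarith
    have hne : S.Nonempty := by
      rw [Set.nonempty_iff_ne_empty]
      rintro rfl
      simp at hv
      linarith
    obtain ⟨x0, hx0, hlt⟩ := exists_lt_of_csInf_lt hne
      (show sInf S < sInf S + (c - (n + 1) * δ) by linarith)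
    have ha : sInf S ≤ x0 := csInf_le hb hx0
    have hcov : S ⊆ Set.Ico (sInf S) (x0 + δ) ∪ (S ∩ Set.Ici (x0 + δ)) := by
      intro y hy
      rcases lt_or_ge y (x0 + δ) with h | h
      · exact Or.inl ⟨csInf_le hb hy, h⟩
      · exact Or.inr ⟨hy, h⟩
    have hv' : ENNReal.ofReal (c - (x0 + δ - sInf S)) ≤ volume (S ∩ Set.Ici (x0 + δ)) := by
      rw [ENNReal.ofReal_sub _ (by linarith), tsub_le_iff_left]
      refine hv.trans ((measure_mono hcov).trans ((measure_union_le _ _).trans ?_))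
      rw [Real.volume_Ico]
    obtain ⟨x, hx, hg⟩ := ih _ _ (by linarith) (hb.mono Set.inter_subset_left) hv'
    refine ⟨fun i => Nat.casesOn i x0 x, ?_, ?_⟩
    · rintro (_ | i) hi
      · exact hx0
      · exact (hx i (by omega)).1
    · rintro (_ | i) hi
      · exact (hx 0 (by omega)).2
      · exact hg i (by omega)

/-- Let `δ > 0`, `ε ∈ [0,1)`, and `N` a positive integer with `N·δ < 1 − ε`.
Then for every Lebesgue-measurable set `T ⊆ (0,1)` of Lebesgue measure at most `ε`, there exist
`N` points `x_1 < x_2 < … < x_N` in `(0,1) \ T` with consecutive gaps at least `δ`. -/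
theorem packing_lemma (δ ε : ℝ) (hδ : 0 < δ) (hε0 : 0 ≤ ε) (hε1 : ε < 1)
    (N : ℕ) (hN : 0 < N) (hNδ : (N : ℝ) * δ < 1 - ε)
    (T : Set ℝ) (hTmeas : MeasurableSet T) (hTsub : T ⊆ Set.Ioo (0 : ℝ) 1)
    (hTvol : MeasureTheory.volume T ≤ ENNReal.ofReal ε) :
    ∃ x : Fin N → ℝ, StrictMono x ∧ (∀ i, x i ∈ Set.Ioo (0 : ℝ) 1 \ T) ∧
      ∀ (i : ℕ) (h : i + 1 < N), δ ≤ x ⟨i + 1, h⟩ - x ⟨i, Nat.lt_of_succ_lt h⟩ := by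
  have hS : ENNReal.ofReal (1 - ε) ≤ MeasureTheory.volume (Set.Ioo (0 : ℝ) 1 \ T) := by
    rw [ENNReal.ofReal_sub _ hε0]
    refine le_trans ?_ MeasureTheory.le_measure_diff
    rw [Real.volume_Ioo, sub_zero]
    exact tsub_le_tsub_left hTvol _
  obtain ⟨x, hx, hg⟩ := packing_aux δ hδ N _ _ hNδ ⟨0, fun y hy => hy.1.1.le⟩ hS
  refine ⟨fun i => x i, ?_, fun i => hx i i.2, fun i h => ?_⟩
  · obtain ⟨n, rfl⟩ : ∃ n, N = n + 1 := ⟨N - 1, by omega⟩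
    rw [Fin.strictMono_iff_lt_succ]
    intro i
    have := hg i (by omega)
    simp only [Fin.val_castSucc, Fin.val_succ]
    linarith
  · have := hg i h
    simp only
    linarith
end
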